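/- There exists a constant τ > 0 depending only on the dimension N with the following property: for every open set Ω ⊆ ℝ^N, every set Z ⊆ Ω with H^{N-1}(Z) < +∞, and every ε > 0, there exists an open set V ⊆ Ω with Z ⊆ V, λ^N(V) ≤ ε, and P(V,Ω) ≤ τ(H^{N-1}(Z) + ε). -/

import Mathlib

open MeasureTheory Metric Filter Set
open scoped ENNReal Topology symmDiff

noncomputable section

abbrev Euc (N : ℕ) : Type := EuclideanSpace ℝ (Fin N)

variable {N : ℕ}

/-- The divergence of a vector field `φ : ℝ^N → ℝ^N`. -/
def diverg (φ : Euc N → Euc N) (x : Euc N) : ℝ :=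
  ∑ i : Fin N, fderiv ℝ φ x (EuclideanSpace.single i 1) i

/-- The admissible test vector fields for the variation in `Ω`:
`C^1`, compactly supported in `Ω`, with `‖φ‖ ≤ 1`. -/
def TestVF (Ω : Set (Euc N)) : Set (Euc N → Euc N) :=
  {φ | ContDiff ℝ 1 φ ∧ HasCompactSupport φ ∧ tsupport φ ⊆ Ω ∧ ∀ x, ‖φ x‖ ≤ 1}

/-- The total variation `V(u, Ω)`. -/
def variation (u : Euc N → ℝ) (Ω : Set (Euc N)) : ℝ≥0∞ :=
  ⨆ φ ∈ TestVF Ω, ENNReal.ofReal (∫ x in Ω, u x * diverg φ x)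

/-- The perimeter `P(A, Ω)` of `A` in `Ω`. -/
def perimeter (A Ω : Set (Euc N)) : ℝ≥0∞ :=
  ⨆ φ ∈ TestVF Ω, ENNReal.ofReal (∫ x in A, diverg φ x)

/-- `u ∈ BV(Ω)`. -/
def MemBV (u : Euc N → ℝ) (Ω : Set (Euc N)) : Prop :=
  IntegrableOn u Ω volume ∧ variation u Ω < ⊤

/-- `u ∈ BV_loc(Ω)`. -/
def MemBVloc (u : Euc N → ℝ) (Ω : Set (Euc N)) : Prop :=
  ∀ Ω' : Set (Euc N), IsOpen Ω' → IsCompact (closure Ω') → closure Ω' ⊆ Ω → MemBV u Ω'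

/-- `u ∈ GBV(Ω)`: measurable, and every truncation `(-m) ∨ u ∧ m` is in `BV_loc(Ω)`. -/
def MemGBV (u : Euc N → ℝ) (Ω : Set (Euc N)) : Prop :=
  AEMeasurable u (volume.restrict Ω) ∧
    ∀ m : ℝ, 0 < m → MemBVloc (fun x => max (-m) (min (u x) m)) Ω

/-- `A` has locally finite perimeter in `Ω`. -/
def HasLocFinPerimeter (A Ω : Set (Euc N)) : Prop :=
  ∀ Ω' : Set (Euc N), IsOpen Ω' → IsCompact (closure Ω') → closure Ω' ⊆ Ω →
    perimeter A Ω' < ⊤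

/-- `A` has density `t` at `x`. -/
def HasDensity (A : Set (Euc N)) (x : Euc N) (t : ℝ) : Prop :=
  Tendsto (fun ρ : ℝ => volume (A ∩ ball x ρ) / volume (ball x ρ)) (𝓝[>] 0)
    (𝓝 (ENNReal.ofReal t))

/-- The approximate upper limit `u⁺(x)` of `u` at `x` (relative to `Ω`), with `inf ∅ = ⊤`. -/
def approxUpper (u : Euc N → ℝ) (Ω : Set (Euc N)) (x : Euc N) : EReal :=
  sInf {t : EReal | ∃ s : ℝ, t = (s : EReal) ∧ HasDensity {y | y ∈ Ω ∧ s < u y} x 0}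

/-- The approximate lower limit `u⁻(x)` of `u` at `x` (relative to `Ω`), with `sup ∅ = ⊥`. -/
def approxLower (u : Euc N → ℝ) (Ω : Set (Euc N)) (x : Euc N) : EReal :=
  sSup {t : EReal | ∃ s : ℝ, t = (s : EReal) ∧ HasDensity {y | y ∈ Ω ∧ u y < s} x 0}

/-- The approximate limit `ũ(x)` exists (i.e. `u⁺(x) = u⁻(x)`) and is `+∞`. -/
def HasApproxLimitTop (u : Euc N → ℝ) (Ω : Set (Euc N)) (x : Euc N) : Prop :=
  approxUpper u Ω x = ⊤ ∧ approxLower u Ω x = ⊤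

/-- The approximate limit `ũ(x)` exists and `|ũ(x)| = +∞`. -/
def HasInfApproxLimit (u : Euc N → ℝ) (Ω : Set (Euc N)) (x : Euc N) : Prop :=
  (approxUpper u Ω x = ⊤ ∧ approxLower u Ω x = ⊤) ∨
    (approxUpper u Ω x = ⊥ ∧ approxLower u Ω x = ⊥)

/-- `C` is `L⁰`-polar in `Ω`. -/
def L0Polar (C Ω : Set (Euc N)) : Prop :=
  ∃ u : Euc N → ℝ, AEMeasurable u (volume.restrict Ω) ∧
    C ⊆ {x | x ∈ Ω ∧ HasInfApproxLimit u Ω x}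

/-- `C` is `BV`-polar in `Ω`. -/
def BVPolar (C Ω : Set (Euc N)) : Prop :=
  ∃ u : Euc N → ℝ, MemBV u Ω ∧ C ⊆ {x | x ∈ Ω ∧ HasInfApproxLimit u Ω x}

/-- `C` is `GBV`-polar in `Ω`. -/
def GBVPolar (C Ω : Set (Euc N)) : Prop :=
  ∃ u : Euc N → ℝ, MemGBV u Ω ∧ C ⊆ {x | x ∈ Ω ∧ HasInfApproxLimit u Ω x}

/-- The set `A^{(1)}` of points of `Ω` where `A` has density `1`. -/
def densityOne (A Ω : Set (Euc N)) : Set (Euc N) :=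
  {x | x ∈ Ω ∧ HasDensity A x 1}

lemma layer_est (m : ℕ) (x : Euc (m + 1)) {r δ : ℝ} (hr : 0 < r) (hδ : 0 < δ) :
    volume (closedBall x r \ ball x (r - δ)) ≤
      ENNReal.ofReal (volume.real (ball (0 : Euc (m + 1)) 1) * (m + 1) * δ * r ^ m) := by
  set c := volume.real (ball (0 : Euc (m + 1)) 1) with hc
  have hc0 : 0 ≤ c := measureReal_nonneg
  have hfin : volume (closedBall x r \ ball x (r - δ)) ≠ ⊤ :=
    ((measure_mono sdiff_subset).trans_lt measure_closedBall_lt_top).ne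
  have hcb : volume.real (closedBall x r) = r ^ (m + 1) * c := by
    have := Measure.addHaar_real_closedBall (volume : Measure (Euc (m + 1))) x hr.le
    simpa [finrank_euclideanSpace] using this
  rw [ENNReal.le_ofReal_iff_toReal_le hfin (by positivity)]
  change volume.real _ ≤ _
  rcases le_or_gt r δ with h | h
  · have h1 : volume.real (closedBall x r \ ball x (r - δ)) ≤ volume.real (closedBall x r) :=
      measureReal_mono sdiff_subset measure_closedBall_lt_top.ne
    rw [hcb] at h1
    refine h1.trans ?_
    have : r ^ (m + 1) ≤ r ^ m * δ := by rw [pow_succ]; gcongr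
    have h2 : r ^ m * δ ≤ (m + 1) * (r ^ m * δ) := by
      have : 0 ≤ (m : ℝ) * (r ^ m * δ) := by positivity
      linarith
    calc r ^ (m + 1) * c ≤ ((m + 1) * (r ^ m * δ)) * c := by gcongr; linarith
      _ = _ := by ring
  · have hb : volume.real (ball x (r - δ)) = (r - δ) ^ (m + 1) * c := by
      rw [measureReal_def, Measure.addHaar_ball_of_pos _ _ (by linarith), ENNReal.toReal_mul,
        ENNReal.toReal_ofReal (pow_nonneg (by linarith) _), finrank_euclideanSpace,
        Fintype.card_fin, hc, measureReal_def]
    rw [measureReal_sdiff (ball_subset_closedBall.trans (closedBall_subset_closedBall (by linarith)))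
      measurableSet_ball measure_closedBall_lt_top.ne, hcb, hb]
    have h1 := abs_pow_sub_pow_le r (r - δ) (m + 1)
    have h2 : |r - (r - δ)| = δ := by rw [sub_sub_cancel, abs_of_pos hδ]
    have h3 : max |r| |r - δ| = r := by
      rw [abs_of_pos hr, abs_of_pos (by linarith), max_eq_left (by linarith)]
    rw [h2, h3, Nat.add_sub_cancel] at h1
    push_cast at h1
    have h4 := (le_abs_self _).trans h1
    calc r ^ (m + 1) * c - (r - δ) ^ (m + 1) * c = (r ^ (m + 1) - (r - δ) ^ (m + 1)) * c := by ring
      _ ≤ (δ * (m + 1) * r ^ m) * c := by gcongr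
      _ = _ := by ring

lemma diverg_eq_zero {φ : Euc N → Euc N} {x : Euc N} (hx : x ∉ tsupport φ) :
    diverg φ x = 0 := by
  have : fderiv ℝ φ x = 0 := by
    by_contra h
    exact hx (tsupport_fderiv_subset ℝ (subset_tsupport _ h))
  simp [diverg, this]

lemma cutoff_bound {V : Set (Euc N)} (hV : Vᶜ.Nonempty) {K : ℝ}
    {δ : ℝ} (hδ : 0 < δ)
    (hK : volume {x | x ∈ V ∧ infDist x Vᶜ < δ} ≤ ENNReal.ofReal (K * δ)) (hK0 : 0 ≤ K)
    (φ : Euc N → Euc N) (h1 : ContDiff ℝ 1 φ) (h2 : HasCompactSupport φ) (h3 : ∀ x, ‖φ x‖ ≤ 1) :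
    ∫ x, min 1 (δ⁻¹ * infDist x Vᶜ) * diverg φ x ≤ N * K := by
  set f : Euc N → ℝ := fun x => min 1 (δ⁻¹ * infDist x Vᶜ) with hf
  obtain ⟨L, hL⟩ : ∃ L : NNReal, (L : ℝ) = δ⁻¹ := ⟨⟨δ⁻¹, by positivity⟩, rfl⟩
  have hLf : LipschitzWith L f := by
    have : LipschitzWith L (fun x : Euc N => δ⁻¹ * infDist x Vᶜ) := by
      have := (lipschitzWith_smul (δ⁻¹)).comp (lipschitz_infDist_pt (Vᶜ))
      refine LipschitzWith.weaken this ?_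
      rw [mul_one, ← NNReal.coe_le_coe]
      simp [hL, abs_of_pos hδ]
    exact this.const_min 1
  have hf0 : ∀ x, 0 ≤ f x := fun x => le_min zero_le_one (mul_nonneg (by positivity) infDist_nonneg)
  have hf1 : ∀ x, f x ≤ 1 := fun x => min_le_left _ _
  set A := {x | x ∈ V ∧ infDist x Vᶜ < δ}
  have hz : ∀ x v, x ∉ A → lineDeriv ℝ f x v = 0 := by
    intro x v hx
    have : f x = 0 ∨ f x = 1 := by
      by_cases hxV : x ∈ V
      · right
        have : δ ≤ infDist x Vᶜ := by
          by_contra h; exact hx ⟨hxV, not_le.1 h⟩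
        apply min_eq_left
        rw [inv_mul_eq_div, le_div_iff₀ hδ]; linarith
      · left
        have : infDist x Vᶜ = 0 := infDist_zero_of_mem hxV
        simp [hf, this]
    unfold lineDeriv
    rcases this with h | h
    · apply IsLocalMin.deriv_eq_zero
      refine Filter.Eventually.of_forall fun t => ?_
      simp only [zero_smul, add_zero, h, hf0]
    · apply IsLocalMax.deriv_eq_zero
      refine Filter.Eventually.of_forall fun t => ?_
      simp only [zero_smul, add_zero, h, hf1]
  have hdiff : Differentiable ℝ φ := h1.differentiable (by norm_num)
  have hg1 : ∀ i : Fin N, ContDiff ℝ 1 (fun x => φ x i) := fun i => by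
    exact contDiff_piLp_apply (p := 2) |>.comp h1
  have hgc : ∀ i : Fin N, HasCompactSupport (fun x => φ x i) := fun i =>
    h2.comp_left (g := fun y : Euc N => y i) (by simp)
  have hline : ∀ i x v, lineDeriv ℝ (fun x => φ x i) x v = fderiv ℝ φ x v i := by
    intro i x v
    rw [((hg1 i).differentiable (by norm_num) x).lineDeriv_eq_fderiv]
    have := ((EuclideanSpace.proj i : Euc N →L[ℝ] ℝ).hasFDerivAt.comp x (hdiff x).hasFDerivAt).fderiv
    have h' : (fun x => φ x i) = (EuclideanSpace.proj i : Euc N →L[ℝ] ℝ) ∘ φ := rfl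
    rw [h', this]; rfl
  have hcont : ∀ i : Fin N, Continuous (fun x => fderiv ℝ φ x (EuclideanSpace.single i 1) i) := by
    intro i
    have := (h1.continuous_fderiv (by norm_num)).clm_apply (continuous_const (y := (EuclideanSpace.single i 1 : Euc N)))
    exact (EuclideanSpace.proj i : Euc N →L[ℝ] ℝ).continuous.comp this
  have hint : ∀ i : Fin N, Integrable (fun x => f x * fderiv ℝ φ x (EuclideanSpace.single i 1) i) := by
    intro i
    apply Continuous.integrable_of_hasCompactSupport (hLf.continuous.mul (hcont i))
    apply HasCompactSupport.mul_left
    exact (h2.fderiv ℝ).comp_left (g := fun T : Euc N →L[ℝ] Euc N => T (EuclideanSpace.single i 1) i) (by simp)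
  have hsum : ∫ x, f x * diverg φ x =
      ∑ i : Fin N, ∫ x, f x * fderiv ℝ φ x (EuclideanSpace.single i 1) i := by
    rw [← integral_finsetSum _ (fun i _ => hint i)]
    simp only [diverg, Finset.mul_sum]
  rw [hsum]
  have hterm : ∀ i : Fin N, ∫ x, f x * fderiv ℝ φ x (EuclideanSpace.single i 1) i ≤ K := by
    intro i
    obtain ⟨D, hD⟩ := (hg1 i).lipschitzWith_of_hasCompactSupport (hgc i) (by norm_num)
    have hp := LipschitzWith.integral_lineDeriv_mul_eq (μ := (volume : Measure (Euc N))) hLf hD (hgc i)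
      (EuclideanSpace.single i 1)
    have e1 : ∫ x, f x * fderiv ℝ φ x (EuclideanSpace.single i 1) i =
        - ∫ x, lineDeriv ℝ f x (EuclideanSpace.single i 1) * φ x i := by
      rw [hp, ← integral_neg]
      congr 1; ext x
      rw [lineDeriv_neg, hline]; ring
    have e2 : ∫ x, lineDeriv ℝ f x (EuclideanSpace.single i 1) * φ x i =
        ∫ x in A, lineDeriv ℝ f x (EuclideanSpace.single i 1) * φ x i := by
      rw [setIntegral_eq_integral_of_forall_compl_eq_zero]
      intro x hx
      rw [hz x _ hx, zero_mul]
    have hA : volume A < ⊤ := hK.trans_lt ENNReal.ofReal_lt_top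
    have e3 : ‖∫ x in A, lineDeriv ℝ f x (EuclideanSpace.single i 1) * φ x i‖ ≤ δ⁻¹ * volume.real A := by
      apply norm_setIntegral_le_of_norm_le_const hA
      intro x _
      rw [norm_mul]
      have a := norm_lineDeriv_le_of_lipschitz ℝ (x₀ := x) (v := (EuclideanSpace.single i 1 : Euc N)) hLf
      have b : ‖φ x i‖ ≤ 1 := (PiLp.norm_apply_le (φ x) i).trans (h3 x)
      have a' : ‖lineDeriv ℝ f x (EuclideanSpace.single i 1)‖ ≤ δ⁻¹ := by
        simpa [hL] using a
      calc _ ≤ δ⁻¹ * 1 := by gcongr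
        _ = _ := mul_one _
    have e4 : volume.real A ≤ K * δ := ENNReal.toReal_le_of_le_ofReal (by positivity) hK
    rw [e1, e2]
    calc _ ≤ ‖∫ x in A, lineDeriv ℝ f x (EuclideanSpace.single i 1) * φ x i‖ := neg_le_abs _
      _ ≤ δ⁻¹ * (K * δ) := e3.trans (by gcongr)
      _ = K := by field_simp
  calc _ ≤ ∑ i : Fin N, K := Finset.sum_le_sum fun i _ => hterm i
    _ = _ := by simp

lemma perimeter_le {V Ω : Set (Euc N)} (hVo : IsOpen V) (hV : Vᶜ.Nonempty) {K : ℝ} (hK0 : 0 ≤ K)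
    (hK : ∀ δ : ℝ, 0 < δ → volume {x | x ∈ V ∧ infDist x Vᶜ < δ} ≤ ENNReal.ofReal (K * δ)) :
    perimeter (V ∩ Ω) Ω ≤ ENNReal.ofReal (N * K) := by
  refine iSup₂_le fun φ hφ => ENNReal.ofReal_le_ofReal ?_
  obtain ⟨h1, h2, h4, h3⟩ := hφ
  have e1 : ∫ x in V ∩ Ω, diverg φ x = ∫ x in V, diverg φ x := by
    symm
    apply setIntegral_eq_of_subset_of_forall_sdiff_eq_zero hVo.measurableSet inter_subset_left
    intro x hx
    exact diverg_eq_zero fun h => hx.2 ⟨hx.1, h4 h⟩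
  have e2 : ∫ x in V, diverg φ x = ∫ x, V.indicator (fun _ => (1 : ℝ)) x * diverg φ x := by
    rw [← integral_indicator hVo.measurableSet]
    congr 1; ext x
    by_cases hx : x ∈ V <;> simp [hx]
  rw [e1, e2]
  have hcont : Continuous (diverg φ) := by
    unfold diverg
    refine continuous_finsetSum _ fun i _ => ?_
    have := (h1.continuous_fderiv (by norm_num)).clm_apply (continuous_const (y := (EuclideanSpace.single i 1 : Euc N)))
    exact (EuclideanSpace.proj i : Euc N →L[ℝ] ℝ).continuous.comp this
  have hcs : HasCompactSupport (diverg φ) :=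
    HasCompactSupport.intro h2 fun x hx => diverg_eq_zero hx
  have hI : Integrable (diverg φ) := hcont.integrable_of_hasCompactSupport hcs
  have hlim : Tendsto (fun k : ℕ => ∫ x, min 1 (((1 : ℝ) / ((k : ℝ) + 1))⁻¹ * infDist x Vᶜ) * diverg φ x) atTop
      (𝓝 (∫ x, V.indicator (fun _ => (1 : ℝ)) x * diverg φ x)) := by
    apply tendsto_integral_of_dominated_convergence (fun x => ‖diverg φ x‖)
    · intro k
      apply Continuous.aestronglyMeasurable
      have := continuous_infDist_pt (Vᶜ)
      fun_prop
    · exact hI.norm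
    · intro k
      refine Filter.Eventually.of_forall fun x => ?_
      rw [norm_mul]
      apply mul_le_of_le_one_left (norm_nonneg _)
      rw [Real.norm_eq_abs, abs_of_nonneg (le_min zero_le_one (mul_nonneg (by positivity) infDist_nonneg))]
      exact min_le_left _ _
    · refine Filter.Eventually.of_forall fun x => Tendsto.mul_const _ ?_
      by_cases hx : x ∈ V
      · have hpos : 0 < infDist x Vᶜ :=
          (hVo.isClosed_compl.notMem_iff_infDist_pos hV).1 (by simpa using hx)
        rw [indicator_of_mem hx]
        apply tendsto_const_nhds.congr'
        obtain ⟨k0, hk0⟩ := exists_nat_gt (1 / infDist x Vᶜ)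
        filter_upwards [eventually_ge_atTop k0] with k hk
        symm
        apply min_eq_left
        have : (k0 : ℝ) ≤ k := by exact_mod_cast hk
        rw [div_lt_iff₀ hpos] at hk0
        rw [one_div, inv_inv]
        nlinarith
      · have : infDist x Vᶜ = 0 := infDist_zero_of_mem hx
        simp [this, hx]
  refine le_of_tendsto' hlim fun k => ?_
  exact cutoff_bound hV (by positivity) (hK _ (by positivity)) hK0 φ h1 h2 h3

lemma exists_cover (m : ℕ) (Z : Set (Euc (m + 1)))
    (hZ : (μH[(m : ℝ)] : Measure (Euc (m + 1))) Z < ⊤) {ε : ℝ} (hε : 0 < ε) {ρ : ℝ} (hρ : 0 < ρ) :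
    ∃ (ι : Type) (_ : Countable ι) (x : ι → Euc (m + 1)) (r : ι → ℝ),
      (∀ i, 0 < r i ∧ r i ≤ ρ) ∧ Z ⊆ ⋃ i, ball (x i) (r i) ∧
      ∑' i, ENNReal.ofReal (r i ^ m) ≤
        (μH[(m : ℝ)] : Measure (Euc (m + 1))) Z + ENNReal.ofReal ε := by
  set H := (μH[(m : ℝ)] : Measure (Euc (m + 1))) Z with hH
  have hlt : H < H + ENNReal.ofReal (ε / 2) :=
    ENNReal.lt_add_right hZ.ne (by simpa using hε)
  have hle : (⨅ (t : ℕ → Set (Euc (m + 1))) (_ : Z ⊆ ⋃ n, t n)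
      (_ : ∀ n, ediam (t n) ≤ ENNReal.ofReal (ρ / 2)),
          ∑' n, ⨆ _ : (t n).Nonempty, ediam (t n) ^ (m : ℝ)) ≤ H := by
    rw [hH, Measure.hausdorffMeasure_apply]
    exact le_iSup₂_of_le (ENNReal.ofReal (ρ / 2)) (by simpa using hρ) le_rfl
  have := hle.trans_lt hlt
  simp only [iInf_lt_iff] at this
  obtain ⟨t, ht, hd, hsum⟩ := this
  set ι := {n // (t n).Nonempty}
  obtain ⟨η, hη, hηs⟩ := ENNReal.exists_pos_sum_of_countable (ε := ENNReal.ofReal (ε / 2))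
    (by simpa using hε) ι
  have hr : ∀ i : ι, ∃ r : ℝ, (ediam (t i)).toReal < r ∧ r ≤ ρ ∧
      r ^ m ≤ (ediam (t i)).toReal ^ m + η i := by
    intro i
    set D := (ediam (t i)).toReal
    have hDρ : D < ρ := by
      have : D ≤ ρ / 2 := ENNReal.toReal_le_of_le_ofReal (by positivity) (hd i)
      linarith
    have c1 : ∀ᶠ r in 𝓝[>] D, r ^ m < D ^ m + η i := by
      have : Tendsto (fun r : ℝ => r ^ m) (𝓝[>] D) (𝓝 (D ^ m)) :=
        ((continuous_pow m).tendsto D).mono_left nhdsWithin_le_nhds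
      exact this.eventually (gt_mem_nhds (by have := hη i; simpa using this))
    have c2 : ∀ᶠ r in 𝓝[>] D, r < ρ := nhdsWithin_le_nhds (gt_mem_nhds hDρ)
    obtain ⟨r, ⟨h1, h2⟩, h3⟩ := ((c1.and c2).and self_mem_nhdsWithin).exists
    exact ⟨r, h3, h2.le, h1.le⟩
  choose r hr1 hr2 hr3 using hr
  refine ⟨ι, inferInstance, fun i => i.2.some, r, fun i => ⟨ENNReal.toReal_nonneg.trans_lt (hr1 i), hr2 i⟩, ?_, ?_⟩
  · intro z hz
    obtain ⟨n, hn⟩ := mem_iUnion.1 (ht hz)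
    refine mem_iUnion.2 ⟨⟨n, ⟨z, hn⟩⟩, ?_⟩
    have hfin : ediam (t n) ≠ ⊤ := ((hd n).trans_lt ENNReal.ofReal_lt_top).ne
    have hne : (t n).Nonempty := ⟨z, hn⟩
    have := edist_le_ediam_of_mem hn hne.some_mem
    rw [mem_ball]
    refine lt_of_le_of_lt ?_ (hr1 ⟨n, hne⟩)
    rw [dist_edist]
    exact ENNReal.toReal_mono hfin this
  · calc ∑' i, ENNReal.ofReal (r i ^ m) ≤ ∑' i : ι, (ediam (t i) ^ (m : ℝ) + (η i : ℝ≥0∞)) := by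
          refine ENNReal.tsum_le_tsum fun i => ?_
          have hfin : ediam (t i) ≠ ⊤ := ((hd i).trans_lt ENNReal.ofReal_lt_top).ne
          refine (ENNReal.ofReal_le_ofReal (hr3 i)).trans ?_
          rw [ENNReal.ofReal_add (by positivity) (by positivity), ENNReal.ofReal_pow (by positivity),
            ENNReal.ofReal_toReal hfin, ENNReal.rpow_natCast, ENNReal.ofReal_coe_nnreal]
      _ = ∑' i : ι, ediam (t i) ^ (m : ℝ) + ∑' i : ι, (η i : ℝ≥0∞) := ENNReal.tsum_add
      _ ≤ (H + ENNReal.ofReal (ε / 2)) + ENNReal.ofReal (ε / 2) := by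
          refine add_le_add (le_trans ?_ hsum.le) hηs.le
          refine le_trans ?_ (ENNReal.tsum_comp_le_tsum_of_injective (f := ((↑) : ι → ℕ)) Subtype.val_injective
            (fun n => ⨆ _ : (t n).Nonempty, ediam (t n) ^ (m : ℝ)))
          exact ENNReal.tsum_le_tsum fun i => le_iSup_of_le i.2 le_rfl
      _ = H + ENNReal.ofReal ε := by
          rw [add_assoc, ← ENNReal.ofReal_add (by positivity) (by positivity), add_halves]

/-- there is a dimensional constant `τ > 0` such that for every open
`Ω ⊆ ℝ^N`, every `Z ⊆ Ω` with `H^{N-1}(Z) < ∞` and every `ε > 0` there is an open set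
`V ⊆ Ω` with `Z ⊆ V`, `λ^N(V) ≤ ε` and `P(V, Ω) ≤ τ (H^{N-1}(Z) + ε)`. -/
theorem statement2 {N : ℕ} :
    ∃ τ : ℝ, 0 < τ ∧
      ∀ Ω : Set (Euc N), IsOpen Ω →
        ∀ Z : Set (Euc N), Z ⊆ Ω → (μH[(N : ℝ) - 1] : Measure (Euc N)) Z < ⊤ →
          ∀ ε : ℝ, 0 < ε →
            ∃ V : Set (Euc N), IsOpen V ∧ V ⊆ Ω ∧ Z ⊆ V ∧
              volume V ≤ ENNReal.ofReal ε ∧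
              perimeter V Ω ≤
                ENNReal.ofReal τ * ((μH[(N : ℝ) - 1] : Measure (Euc N)) Z + ENNReal.ofReal ε) := by
  rcases N with _ | m
  · refine ⟨1, one_pos, fun Ω _ Z _ hZ ε _ => ⟨∅, isOpen_empty, empty_subset _, ?_, by simp, ?_⟩⟩
    · intro z hz
      exfalso
      refine hZ.ne (top_le_iff.1 ?_)
      rw [Measure.hausdorffMeasure_apply]
      refine le_iSup₂_of_le 1 one_pos ?_
      refine le_iInf fun t => le_iInf fun ht => le_iInf fun _ => ?_
      obtain ⟨n, hn⟩ := mem_iUnion.1 (ht hz)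
      refine le_trans ?_ (ENNReal.le_tsum n)
      refine le_iSup_of_le ⟨z, hn⟩ ?_
      have : ediam (t n) = 0 := ediam_subsingleton (subsingleton_of_subsingleton)
      rw [this, ENNReal.zero_rpow_of_neg (by norm_num)]
    · simp [perimeter]
  · set c := volume.real (ball (0 : Euc (m + 1)) 1) with hc
    have hc0 : 0 < c := ENNReal.toReal_pos (measure_ball_pos _ _ one_pos).ne' measure_ball_lt_top.ne
    have hcE : volume (ball (0 : Euc (m + 1)) 1) = ENNReal.ofReal c :=
      (ENNReal.ofReal_toReal measure_ball_lt_top.ne).symm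
    refine ⟨(m + 1) * (c * (m + 1)), by positivity, fun Ω hΩ Z hZΩ hZ ε hε => ?_⟩
    have hdim : (((m + 1 : ℕ) : ℝ) - 1) = (m : ℝ) := by push_cast; ring
    rw [hdim] at hZ ⊢
    set H := (μH[(m : ℝ)] : Measure (Euc (m + 1))) Z with hH
    set h := H.toReal with hh
    have hHh : H = ENNReal.ofReal h := (ENNReal.ofReal_toReal hZ.ne).symm
    have hh0 : 0 ≤ h := ENNReal.toReal_nonneg
    set ρ := ε / (c * (h + ε)) with hρ
    have hρ0 : 0 < ρ := by positivity
    obtain ⟨ι, _, x, r, hr, hcov, hsum⟩ := exists_cover m Z hZ hε hρ0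
    rw [← hH] at hsum
    set S := ∑' i, ENNReal.ofReal (r i ^ m) with hS
    have hSfin : S ≠ ⊤ := (hsum.trans_lt (ENNReal.add_lt_top.2 ⟨hZ, ENNReal.ofReal_lt_top⟩)).ne
    set V := ⋃ i, ball (x i) (r i) with hVdef
    have hVo : IsOpen V := isOpen_iUnion fun i => isOpen_ball
    have hvol : volume V ≤ ENNReal.ofReal ε := by
      calc volume V ≤ ∑' i, volume (ball (x i) (r i)) := measure_iUnion_le _
        _ ≤ ∑' i, ENNReal.ofReal (c * ρ) * ENNReal.ofReal (r i ^ m) := by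
            refine ENNReal.tsum_le_tsum fun i => ?_
            obtain ⟨h1, h2⟩ := hr i
            rw [Measure.addHaar_ball_of_pos _ _ h1, hcE, finrank_euclideanSpace, Fintype.card_fin,
              ← ENNReal.ofReal_mul (by positivity), ← ENNReal.ofReal_mul (by positivity)]
            apply ENNReal.ofReal_le_ofReal
            calc r i ^ (m + 1) * c = c * r i * r i ^ m := by ring
              _ ≤ c * ρ * r i ^ m := by gcongr
        _ = ENNReal.ofReal (c * ρ) * S := ENNReal.tsum_mul_left
        _ ≤ ENNReal.ofReal (c * ρ) * (H + ENNReal.ofReal ε) := by gcongr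
        _ = ENNReal.ofReal ε := by
            rw [hHh, ← ENNReal.ofReal_add hh0 hε.le, ← ENNReal.ofReal_mul (by positivity)]
            congr 1
            rw [hρ]; field_simp
    have hVc : Vᶜ.Nonempty := by
      rw [nonempty_compl]
      intro hu
      rw [hu, measure_univ_of_isAddLeftInvariant] at hvol
      exact absurd hvol (by simp)
    refine ⟨V ∩ Ω, hVo.inter hΩ, inter_subset_right, subset_inter hcov hZΩ,
      (measure_mono inter_subset_left).trans hvol, ?_⟩
    have hP := perimeter_le (Ω := Ω) hVo hVc (K := c * (m + 1) * S.toReal) (by positivity) ?_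
    · refine hP.trans ?_
      calc ENNReal.ofReal (((m + 1 : ℕ) : ℝ) * (c * (m + 1) * S.toReal))
          = ENNReal.ofReal ((m + 1) * (c * (m + 1))) * S := by
            rw [← mul_assoc, ENNReal.ofReal_mul (by positivity), ENNReal.ofReal_toReal hSfin]
            push_cast; rfl
        _ ≤ _ := by gcongr
    · intro δ hδ
      calc volume {y | y ∈ V ∧ infDist y Vᶜ < δ}
          ≤ volume (⋃ i, closedBall (x i) (r i) \ ball (x i) (r i - δ)) := by
            apply measure_mono
            rintro y ⟨hy, hyd⟩
            obtain ⟨i, hi⟩ := mem_iUnion.1 hy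
            refine mem_iUnion.2 ⟨i, ball_subset_closedBall hi, fun hb => ?_⟩
            obtain ⟨w, hw, hyw⟩ := (infDist_lt_iff hVc).1 hyd
            apply hw
            refine mem_iUnion.2 ⟨i, ?_⟩
            rw [mem_ball] at hb ⊢
            have := dist_triangle w y (x i)
            rw [dist_comm w y] at this
            linarith
        _ ≤ ∑' i, volume (closedBall (x i) (r i) \ ball (x i) (r i - δ)) := measure_iUnion_le _
        _ ≤ ∑' i, ENNReal.ofReal (c * (m + 1) * δ) * ENNReal.ofReal (r i ^ m) := by
            refine ENNReal.tsum_le_tsum fun i => ?_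
            rw [← ENNReal.ofReal_mul (by positivity)]
            exact layer_est m (x i) (hr i).1 hδ
        _ = ENNReal.ofReal (c * (m + 1) * δ) * S := ENNReal.tsum_mul_left
        _ = ENNReal.ofReal (c * (m + 1) * S.toReal * δ) := by
            rw [show c * (m + 1) * S.toReal * δ = (c * (m + 1) * δ) * S.toReal by ring,
              ENNReal.ofReal_mul (p := c * (m + 1) * δ) (by positivity), ENNReal.ofReal_toReal hSfin]
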